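/- arXiv:2205.14750 — 4 statements merged into one kernel-verified Lean document; each statement's English description precedes it below -/
import Mathlib

section
/- Let C and D be categories, let F, F′ : C ⥤ D be functors each admitting a right adjoint, and let A be a class of objects of C that generates C. If α : F ⟶ F′ is a natural transformation such that the component α_X : F(X) → F′(X) is an isomorphism for every X ∈ A, then α is a natural isomorphism, i.e. α_Y : F(Y) → F′(Y) is an isomorphism for every object Y of C. -/
open CategoryTheory

/-- Let `C` and `D` be categories, `F F' : C ⥤ D` functors each admitting a
right adjoint, and `A` a class of objects of `C` that generates `C` (i.e. the functors
`Hom_C(X, -)` for `X ∈ A` are jointly conservative).  If `α : F ⟶ F'` is a natural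
transformation whose component at every `X ∈ A` is an isomorphism, then every component of
`α` is an isomorphism. -/
theorem statement0 {C D : Type*} [Category C] [Category D]
    (F F' : C ⥤ D) [F.IsLeftAdjoint] [F'.IsLeftAdjoint]
    (A : Set C)
    (hA : ∀ {Y Z : C} (g : Y ⟶ Z),
      (∀ X ∈ A, Function.Bijective (fun f : X ⟶ Y => f ≫ g)) → IsIso g)
    (α : F ⟶ F') (hα : ∀ X ∈ A, IsIso (α.app X)) :
    ∀ Y : C, IsIso (α.app Y) := by
  let adj := Adjunction.ofIsLeftAdjoint F
  let adj' := Adjunction.ofIsLeftAdjoint F'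
  have key : ∀ d, IsIso ((conjugateEquiv adj' adj α).app d) := by
    intro d
    apply hA
    intro X hX
    have := hα X hX
    have e : (fun f : X ⟶ _ => f ≫ (conjugateEquiv adj' adj α).app d) =
        fun f => adj.homEquiv X d (α.app X ≫ (adj'.homEquiv X d).symm f) := by
      funext f
      apply (adj.homEquiv X d).symm.injective
      rw [Equiv.symm_apply_apply, Adjunction.homEquiv_counit, Adjunction.homEquiv_counit,
        Functor.map_comp, Category.assoc, conjugateEquiv_counit]
      simp
    rw [e]
    exact (adj.homEquiv X d).bijective.comp
      (((asIso (α.app X)).homFromEquiv (Z := d)).symm.bijective.comp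
        (adj'.homEquiv X d).symm.bijective)
  have : IsIso (conjugateEquiv adj' adj α) := NatIso.isIso_of_isIso_app _
  have : IsIso α := conjugateEquiv_of_iso adj' adj α
  intro Y
  infer_instance
end

section
/- Let P be a fine saturated commutative monoid. Then the quotient homomorphism π : P → P̄ = P/P* admits a section which is a monoid homomorphism: there exists a monoid homomorphism s : P̄ → P with π ∘ s = id. -/
/-- The congruence on an additive commutative monoid `P` identifying `a` and `b` whenever
`a = b + u` for some unit `u`; the quotient is `P̄ = P/P*`. -/
def unitsCon (P : Type*) [AddCommMonoid P] : AddCon P :=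
  addConGen (fun a b => ∃ u : AddUnits P, a = b + (u : P))

/-- A commutative monoid is saturated if `n • a = n • b + c` (for some `c` and some `n ≥ 1`)
implies `a = b + d` for some `d`. -/
def IsSaturated (P : Type*) [AddCommMonoid P] : Prop :=
  ∀ a b : P, ∀ n : ℕ, 1 ≤ n → (∃ c : P, n • a = n • b + c) → ∃ d : P, a = b + d

/-- Let `P` be a fine (finitely generated and cancellative) saturated
commutative monoid.  Then the quotient homomorphism `π : P → P̄ = P/P*` admits a section
which is a monoid homomorphism. -/
theorem statement1 (P : Type*) [AddCommMonoid P] [IsCancelAdd P] [AddMonoid.FG P]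
    (hsat : IsSaturated P) :
    ∃ s : (unitsCon P).Quotient →+ P,
      ((unitsCon P).mk').comp s = AddMonoidHom.id (unitsCon P).Quotient := by
  classical
  let of : P →+ Algebra.GrothendieckAddGroup P := Algebra.GrothendieckAddGroup.of
  have hof : Function.Injective of := Algebra.GrothendieckAddGroup.of_injective
  have hsurj : ∀ x, ∃ a b : P, x = of a - of b := by
    intro x
    obtain ⟨⟨a, b⟩, h⟩ := (AddLocalization.addMonoidOf (⊤ : AddSubmonoid P)).surj x
    exact ⟨a, b, eq_sub_of_add_eq h⟩
  let i : AddUnits P →+ Algebra.GrothendieckAddGroup P := of.comp (AddUnits.coeHom P)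
  have hi : Function.Injective i := hof.comp AddUnits.val_injective
  let H : AddSubgroup (Algebra.GrothendieckAddGroup P) := i.range
  let N : Submodule ℤ (Algebra.GrothendieckAddGroup P) := AddSubgroup.toIntSubmodule H
  have hN : ∀ x, x ∈ N ↔ ∃ u : AddUnits P, of u = x := fun x => Iff.rfl
  have key : ∀ (n : ℕ) (x : Algebra.GrothendieckAddGroup P), 1 ≤ n → n • x ∈ N → x ∈ N := by
    intro n x hn hx
    obtain ⟨a, b, rfl⟩ := hsurj x
    obtain ⟨u, hu⟩ := (hN _).1 hx
    have h1 : n • a = n • b + u := by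
      apply hof
      rw [map_add, hu, map_nsmul, map_nsmul, smul_sub]; abel
    have h2 : n • b = n • a + ((-u : AddUnits P) : P) := by
      rw [h1, add_assoc, AddUnits.add_neg, add_zero]
    obtain ⟨d, hd⟩ := hsat a b n hn ⟨_, h1⟩
    obtain ⟨e, he⟩ := hsat b a n hn ⟨_, h2⟩
    have hde : d + e = 0 := by
      apply add_left_cancel (a := b)
      rw [← add_assoc, ← hd, ← he, add_zero]
    refine (hN _).2 ⟨⟨d, e, hde, by rw [add_comm, hde]⟩, ?_⟩
    change of d = _
    rw [hd, map_add]; abel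
  have : IsAddTorsionFree (Algebra.GrothendieckAddGroup P ⧸ N) := by
    refine ⟨fun n hn => ?_⟩
    intro x y hxy
    obtain ⟨x, rfl⟩ := N.mkQ_surjective x
    obtain ⟨y, rfl⟩ := N.mkQ_surjective y
    simp only [← map_nsmul] at hxy
    rw [← sub_eq_zero, ← map_sub, Submodule.mkQ_apply, Submodule.Quotient.mk_eq_zero] at hxy ⊢
    rw [← smul_sub] at hxy
    exact key n _ (Nat.one_le_iff_ne_zero.2 hn) hxy
  have : AddMonoid.FG (Algebra.GrothendieckAddGroup P) := AddLocalization.fg (AddMonoid.FG.fg_top)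
  have : AddGroup.FG (Algebra.GrothendieckAddGroup P) := AddGroup.fg_iff_addMonoid_fg.2 this
  have : Module.Finite ℤ (Algebra.GrothendieckAddGroup P) := Module.Finite.iff_addGroup_fg.2 this
  have : Module.Free ℤ (Algebra.GrothendieckAddGroup P ⧸ N) := inferInstance
  obtain ⟨t, ht⟩ := Module.projective_lifting_property N.mkQ LinearMap.id N.mkQ_surjective
  have ht' : ∀ x, N.mkQ (t x) = x := fun x => LinearMap.congr_fun ht x
  have hr : ∀ p : P, ∃ u : AddUnits P, of u = of p - t (N.mkQ (of p)) := by
    intro p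
    rw [← hN, ← Submodule.Quotient.mk_eq_zero, ← Submodule.mkQ_apply, map_sub, ht', sub_self]
  choose ρ hρ using hr
  have hs : ∀ p, of (p + ((-ρ p : AddUnits P) : P)) = t (N.mkQ (of p)) := by
    intro p
    have h : of (ρ p) + of ((-ρ p : AddUnits P) : P) = 0 := by
      rw [← map_add, AddUnits.add_neg, map_zero]
    rw [map_add, eq_neg_of_add_eq_zero_right h, hρ]; abel
  let s0 : P →+ P :=
    { toFun := fun p => p + ((-ρ p : AddUnits P) : P)
      map_zero' := by apply hof; rw [hs]; simp
      map_add' := by intro a b; apply hof; rw [hs, map_add of (a + _), hs, hs]; simp }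
  have hs0 : ∀ p, of (s0 p) = t (N.mkQ (of p)) := hs
  have hle : unitsCon P ≤ AddCon.ker s0 := by
    refine AddCon.addConGen_le.2 ?_
    rintro a b ⟨u, rfl⟩
    rw [AddCon.ker_rel]
    apply hof
    have : N.mkQ (of (u : P)) = 0 := by
      rw [Submodule.mkQ_apply, Submodule.Quotient.mk_eq_zero]
      exact (hN _).2 ⟨u, rfl⟩
    rw [hs0, hs0, map_add, map_add, this, add_zero]
  refine ⟨(unitsCon P).lift s0 hle, ?_⟩
  ext p
  change ((s0 p : P) : (unitsCon P).Quotient) = (p : (unitsCon P).Quotient)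
  exact (AddCon.eq _).2 (AddConGen.Rel.of _ _ ⟨-ρ p, rfl⟩)
end

section
/- Let P be a cancellative commutative monoid (written additively), P* its group of units, P̄ = P/P*, and π : P → P̄ the quotient homomorphism (P̄ is again cancellative). Let π^gp : K(P) → K(P̄) be the induced homomorphism of Grothendieck groups. If η : K(P̄) → K(P) is a group homomorphism with π^gp ∘ η = id, then η maps the image of P̄ in K(P̄) into the image of P in K(P); consequently η induces a monoid homomorphism s : P̄ → P with π ∘ s = id. -/
theorem unitsCon_exists (P : Type*) [AddCommMonoid P] {a b : P} (h : unitsCon P a b) :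
    ∃ u : AddUnits P, a = b + (u : P) := by
  change AddConGen.Rel _ a b at h
  induction h with
  | of x y h => exact h
  | refl x => exact ⟨0, by simp⟩
  | symm _ ih =>
    obtain ⟨u, rfl⟩ := ih
    exact ⟨-u, by simp [add_assoc]⟩
  | trans _ _ ih1 ih2 =>
    obtain ⟨u, rfl⟩ := ih1
    obtain ⟨v, rfl⟩ := ih2
    exact ⟨v + u, by simp [add_assoc]⟩
  | add _ _ ih1 ih2 =>
    obtain ⟨u, rfl⟩ := ih1
    obtain ⟨v, rfl⟩ := ih2
    exact ⟨u + v, by rw [AddUnits.val_add, add_add_add_comm]⟩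

/-- Let `P` be a cancellative commutative monoid with quotient
`π : P → P̄ = P/P*`.  Let `K = K(P)` and `K' = K(P̄)` be the Grothendieck groups (encoded
abstractly: `ι : P →+ K` is injective and every element of `K` is a difference `ι a - ι b`,
and similarly for `ι' : P̄ →+ K'`), and let `g = π^gp : K →+ K'` be the induced homomorphism
(i.e. `g ∘ ι = ι' ∘ π`).  If `η : K' →+ K` is a group homomorphism with `g ∘ η = id`, then
`η` maps the image of `P̄` into the image of `P`; consequently `η` induces a monoid
homomorphism `s : P̄ →+ P` with `π ∘ s = id`. -/
theorem statement3 (P : Type*) [AddCommMonoid P] [IsCancelAdd P]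
    (K K' : Type*) [AddCommGroup K] [AddCommGroup K']
    (ι : P →+ K) (hι : Function.Injective ι)
    (hK : ∀ x : K, ∃ a b : P, x = ι a - ι b)
    (ι' : (unitsCon P).Quotient →+ K') (hι' : Function.Injective ι')
    (hK' : ∀ x : K', ∃ a b : (unitsCon P).Quotient, x = ι' a - ι' b)
    (g : K →+ K') (hg : ∀ a : P, g (ι a) = ι' ((unitsCon P).mk' a))
    (η : K' →+ K) (hη : g.comp η = AddMonoidHom.id K') :
    (∀ q : (unitsCon P).Quotient, ∃ p : P, η (ι' q) = ι p) ∧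
    ∃ s : (unitsCon P).Quotient →+ P,
      (∀ q : (unitsCon P).Quotient, ι (s q) = η (ι' q)) ∧
      ((unitsCon P).mk').comp s = AddMonoidHom.id (unitsCon P).Quotient := by
  have hgη : ∀ x, g (η x) = x := fun x => DFunLike.congr_fun hη x
  have h1 : ∀ q : (unitsCon P).Quotient, ∃ p : P, η (ι' q) = ι p := by
    intro q
    obtain ⟨p, rfl⟩ := AddCon.mk'_surjective (c := unitsCon P) q
    obtain ⟨a, b, hab⟩ := hK (η (ι' ((unitsCon P).mk' p)))
    have h := congrArg g hab
    rw [hgη, map_sub, hg, hg, eq_sub_iff_add_eq, ← map_add, ← map_add] at h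
    have h2 := (unitsCon P).eq.1 (hι' h)
    obtain ⟨u, hu⟩ := unitsCon_exists P ((unitsCon P).symm h2)
    refine ⟨p + u, ?_⟩
    rw [hab, hu, map_add, map_add, map_add]
    abel
  refine ⟨h1, ?_⟩
  choose f hf using h1
  refine ⟨⟨⟨f, hι ?_⟩, fun x y => hι ?_⟩, fun q => (hf q).symm, ?_⟩
  · rw [← hf]; simp
  · change ι (f (x + y)) = ι (f x + f y)
    rw [← hf, map_add ι, ← hf, ← hf, map_add, map_add]
  · ext q
    apply hι'
    change ι' ((unitsCon P).mk' (f _)) = ι' _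
    rw [← hg, ← hf, hgη]
    rfl
end

section
/- Let θ : P → Q and η : Q → R be homomorphisms of cancellative saturated commutative monoids. If η is exact and the composite η ∘ θ is vertical, then θ is vertical. -/
/-- A face of a commutative monoid `Q` is a submonoid `F` such that `x + y ∈ F` implies
`x ∈ F` and `y ∈ F`. -/
def IsFace {Q : Type*} [AddCommMonoid Q] (F : AddSubmonoid Q) : Prop :=
  ∀ x y : Q, x + y ∈ F → x ∈ F ∧ y ∈ F

/-- A homomorphism `θ : P → Q` of commutative monoids is vertical if the only face of `Q`
containing the image of `θ` is `Q` itself. -/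
def IsVertical {P Q : Type*} [AddCommMonoid P] [AddCommMonoid Q] (θ : P →+ Q) : Prop :=
  ∀ F : AddSubmonoid Q, IsFace F → (∀ p : P, θ p ∈ F) → F = ⊤

/-- A homomorphism `η : Q → R` of cancellative commutative monoids is exact if
`η a = η b + c` (for some `c : R`) implies `a = b + d` for some `d : Q`. -/
def IsExactHom {Q R : Type*} [AddCommMonoid Q] [AddCommMonoid R] (η : Q →+ R) : Prop :=
  ∀ a b : Q, (∃ c : R, η a = η b + c) → ∃ d : Q, a = b + d

/-- Let `θ : P → Q` and `η : Q → R` be homomorphisms of cancellative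
saturated commutative monoids.  If `η` is exact and `η ∘ θ` is vertical, then `θ` is
vertical. -/
theorem statement4 {P Q R : Type*}
    [AddCommMonoid P] [IsCancelAdd P] [AddCommMonoid Q] [IsCancelAdd Q]
    [AddCommMonoid R] [IsCancelAdd R]
    (hP : IsSaturated P) (hQ : IsSaturated Q) (hR : IsSaturated R)
    (θ : P →+ Q) (η : Q →+ R)
    (hexact : IsExactHom η) (hvert : IsVertical (η.comp θ)) :
    IsVertical θ := by
  intro F hF hθ
  let G : AddSubmonoid R :=
    { carrier := {r | ∃ p c, η (θ p) = r + c}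
      zero_mem' := ⟨0, 0, by simp⟩
      add_mem' := by
        rintro a b ⟨p, c, h⟩ ⟨p', c', h'⟩
        refine ⟨p + p', c + c', ?_⟩
        rw [map_add, map_add, h, h', add_add_add_comm] }
  have hG : IsFace G := by
    rintro x y ⟨p, c, h⟩
    exact ⟨⟨p, y + c, by rw [h, add_assoc]⟩, ⟨p, x + c, by rw [h, add_comm x y, add_assoc]⟩⟩
  have hT : G = ⊤ := hvert G hG (fun p => ⟨p, 0, by simp⟩)
  rw [eq_top_iff]
  intro q _
  have hq : η q ∈ G := by rw [hT]; trivial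
  obtain ⟨p, c, h⟩ := hq
  obtain ⟨d, hd⟩ := hexact (θ p) q ⟨c, h⟩
  exact (hF q d (hd ▸ hθ p)).1
end
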